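/- Let R be a commutative ring, M a free R-module with basis m₁, …, m_l, and N an R-module. Let f : M → N be an R-linear map such that for every nonzero r ∈ R the element r • (f(m₁) ∧ ⋯ ∧ f(m_l)) is nonzero in the l-th exterior power ⋀^l N. Then for every k with 1 ≤ k ≤ l, the induced R-linear map ⋀^k f : ⋀^k M → ⋀^k N between k-th exterior powers is injective. -/

import Mathlib

open ExteriorAlgebra

/-- The map between `k`-th exterior powers induced by a linear map `f : M →ₗ[R] N`,
obtained by restricting the algebra morphism `ExteriorAlgebra.map f` to the
submodule `⋀[R]^k M`. -/
noncomputable def exteriorPowerMap {R M N : Type*} [CommRing R] [AddCommGroup M] [Module R M]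
    [AddCommGroup N] [Module R N] (k : ℕ) (f : M →ₗ[R] N) :
    ⋀[R]^k M →ₗ[R] ⋀[R]^k N :=
  (ExteriorAlgebra.map f).toLinearMap.restrict
    (p := ⋀[R]^k M) (q := ⋀[R]^k N) (by
      intro x hx
      rw [← ExteriorAlgebra.ιMulti_span_fixedDegree] at hx ⊢
      induction hx using Submodule.span_induction with
      | mem x hx =>
          obtain ⟨v, rfl⟩ := hx
          rw [AlgHom.toLinearMap_apply, ExteriorAlgebra.map_apply_ιMulti]
          exact Submodule.subset_span ⟨_, rfl⟩
      | zero => simp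
      | add x y _ _ hx hy => rw [map_add]; exact Submodule.add_mem _ hx hy
      | smul r x _ hx => rw [map_smul]; exact Submodule.smul_mem _ r hx)

theorem ιMulti_mul_append_aux {R N : Type*} [CommRing R] [AddCommGroup N] [Module R N]
    {k m : ℕ} (u : Fin k → N) (w : Fin m → N) :
    ExteriorAlgebra.ιMulti R k u * ExteriorAlgebra.ιMulti R m w =
      ExteriorAlgebra.ιMulti R (k + m) (Fin.append u w) := by
  rw [ExteriorAlgebra.ιMulti_apply, ExteriorAlgebra.ιMulti_apply, ExteriorAlgebra.ιMulti_apply,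
    ← List.prod_append, ← List.ofFn_fin_append]
  congr 2
  ext i
  refine Fin.addCases (fun i => ?_) (fun i => ?_) i <;> simp

/-- Let `M` be a free `R`-module with basis `m₁, …, m_l`, `N` an `R`-module,
and `f : M →ₗ[R] N` a linear map such that `r • (f m₁ ∧ ⋯ ∧ f m_l) ≠ 0` in `⋀[R]^l N`
for every nonzero `r : R`.  Then for every `1 ≤ k ≤ l`, the induced map
`⋀^k f : ⋀[R]^k M →ₗ[R] ⋀[R]^k N` is injective. -/
theorem exteriorPowerMap_injective_of_smul_wedge_ne_zero
    {R M N : Type*} [CommRing R] [AddCommGroup M] [Module R M]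
    [AddCommGroup N] [Module R N] {l : ℕ} (b : Module.Basis (Fin l) R M) (f : M →ₗ[R] N)
    (h : ∀ r : R, r ≠ 0 →
      r • (ExteriorAlgebra.ιMulti R l (fun i => f (b i)) : ExteriorAlgebra R N) ≠ 0)
    (k : ℕ) (hk1 : 1 ≤ k) (hkl : k ≤ l) :
    Function.Injective (exteriorPowerMap k f) := by
  classical
  obtain ⟨m, rfl⟩ := Nat.exists_eq_add_of_le hkl
  rw [injective_iff_map_eq_zero]
  intro x hx
  let B := b.exteriorPower k
  have hsum : ∑ s, B.repr x s •
      ExteriorAlgebra.ιMulti R k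
        (fun i => f (b (Set.powersetCard.ofFinEmbEquiv.symm s i))) = 0 := by
    have h1 : ExteriorAlgebra.map f (x : ExteriorAlgebra R M) = 0 := congrArg Subtype.val hx
    rw [← B.sum_repr x] at h1
    simp only [Submodule.coe_sum, Submodule.coe_smul, map_sum, map_smul] at h1
    rw [← h1]
    refine Finset.sum_congr rfl fun s _ => ?_
    congr 1
    simp only [B, exteriorPower.basis_apply, exteriorPower.ιMulti_family,
      exteriorPower.ιMulti_apply_coe, ExteriorAlgebra.map_apply_ιMulti]
    rfl
  apply B.repr.injective
  rw [map_zero]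
  ext t
  rw [Finsupp.zero_apply]
  by_contra hne
  -- the complementary index
  have hcard : ((t : Finset (Fin (k + m)))ᶜ).card = m := by
    rw [Finset.card_compl, Fintype.card_fin, t.2]; omega
  let c : Fin m ↪o Fin (k + m) := ((t : Finset (Fin (k + m)))ᶜ).orderEmbOfFin hcard
  have hc : ∀ i, (i ∈ Set.range c) ↔ i ∉ (t : Finset (Fin (k + m))) := by
    intro i
    rw [Finset.range_orderEmbOfFin, Finset.mem_coe, Finset.mem_compl]
  have hmem : ∀ (s : Set.powersetCard (Fin (k + m)) k) i,
      i ∈ Set.range (Set.powersetCard.ofFinEmbEquiv.symm s) ↔ i ∈ (s : Finset (Fin (k + m))) :=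
    fun s i => Set.powersetCard.mem_range_ofFinEmbEquiv_symm_iff_mem s i
  have key : ∀ s : Set.powersetCard (Fin (k + m)) k,
      ExteriorAlgebra.ιMulti R k (fun i => f (b (Set.powersetCard.ofFinEmbEquiv.symm s i))) *
        ExteriorAlgebra.ιMulti R m (fun i => f (b (c i))) =
      ExteriorAlgebra.ιMulti R (k + m) (fun i => f (b
        (Fin.append (Set.powersetCard.ofFinEmbEquiv.symm s) c i))) := by
    intro s
    rw [ιMulti_mul_append_aux]
    congr 1
    ext i
    refine Fin.addCases (fun i => ?_) (fun i => ?_) i <;> simp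
  have hinj : Function.Injective (Fin.append (Set.powersetCard.ofFinEmbEquiv.symm t) c) := by
    rw [Fin.append_injective_iff]
    refine ⟨(Set.powersetCard.ofFinEmbEquiv.symm t).injective, c.injective, fun i j hij => ?_⟩
    exact (hc _).1 ⟨j, rfl⟩ (hij ▸ (hmem t _).1 ⟨i, rfl⟩)
  have hoff : ∀ s, s ≠ t → ExteriorAlgebra.ιMulti R (k + m) (fun i => f (b
        (Fin.append (Set.powersetCard.ofFinEmbEquiv.symm s) c i))) = 0 := by
    intro s hs
    obtain ⟨i, his, hit⟩ := (Set.powersetCard.exists_mem_notMem_iff_ne s t).mp hs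
    obtain ⟨p, hp⟩ := (hmem s i).2 his
    obtain ⟨q, hq⟩ := (hc i).2 hit
    refine AlternatingMap.map_eq_zero_of_eq _ _ (i := Fin.castAdd m p) (j := Fin.natAdd k q) ?_ ?_
    · simp only [Fin.append_left, Fin.append_right, hp, hq]
    · intro e
      have := congrArg Fin.val e
      simp at this
      omega
  have h2 := congrArg (· * ExteriorAlgebra.ιMulti R m (fun i => f (b (c i)))) hsum
  simp only [Finset.sum_mul, smul_mul_assoc, key, zero_mul] at h2
  rw [Finset.sum_eq_single t (fun s _ hs => by rw [hoff s hs, smul_zero]) (by simp)] at h2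
  let σ : Equiv.Perm (Fin (k + m)) :=
    Equiv.ofBijective _ (Finite.injective_iff_bijective.mp hinj)
  have h3 := AlternatingMap.map_perm (ExteriorAlgebra.ιMulti R (k + m)) (fun i => f (b i)) σ
  have h4 : ((fun i => f (b i)) ∘ σ) = (fun i => f (b
        (Fin.append (Set.powersetCard.ofFinEmbEquiv.symm t) c i))) := rfl
  rw [h4] at h3
  rw [h3, smul_comm] at h2
  exact h _ hne ((smul_eq_zero_iff_eq _).1 h2)
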